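/- Let M ∈ F_2^{m×n} and b,b′ ∈ F_2^m, and let u be a magic unitary over a unital C*-algebra with rows indexed by V(G(M,b)) and columns indexed by V(G(M,b′)) satisfying the isomorphism relations. For each i ∈ [n] belonging to some S_k, the element y_i := Σ_{β ∈ ±1^{S_k}_{b′_k}} α_i β_i · u_{(k,α),(k,β)} is independent of the choice of k ∈ [m] with i ∈ S_k and of α ∈ ±1^{S_k}_{b_k}; moreover y_i* = y_i and y_i² = 1; y_i y_j = y_j y_i whenever i,j ∈ S_k for some k; and for every k ∈ [m], ∏_{i∈S_k} y_i = (−1)^{b_k + b′_k} (product in increasing order of indices, with (−1)^{b_k+b′_k} = −1 exactly when b_k ≠ b′_k). -/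

import Mathlib

open scoped BigOperators

/-- A magic unitary over a ring with star: every entry is a projection and
every row and column sums to `1`. -/
def IsMagicUnitary {I J A : Type*} [Fintype I] [Fintype J] [Ring A] [StarRing A]
    (u : I → J → A) : Prop :=
  (∀ i j, star (u i j) = u i j) ∧ (∀ i j, u i j * u i j = u i j) ∧
    (∀ i, ∑ j, u i j = 1) ∧ (∀ j, ∑ i, u i j = 1)

/-- The sign `(-1)^x` for `x ∈ F₂`. -/
def signZ (x : ZMod 2) : ℤˣ := if x = 0 then 1 else -1

/-- `S_k = {i : M k i = 1}`. -/
def Sk {m n : ℕ} (M : Matrix (Fin m) (Fin n) (ZMod 2)) (k : Fin m) : Finset (Fin n) :=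
  Finset.univ.filter fun i => M k i = 1

/-- The vertex set of the colored graph `G(M,b)`: pairs `(k, α)` where
`α : ±1^{S_k}` with `∏_{i ∈ S_k} α i = (-1)^{b k}`, encoded as functions on `Fin n`
normalized to `1` off `S_k`. -/
abbrev GVertex {m n : ℕ} (M : Matrix (Fin m) (Fin n) (ZMod 2)) (b : Fin m → ZMod 2) : Type :=
  {p : Fin m × (Fin n → ℤˣ) //
    (∀ i, i ∉ Sk M p.1 → p.2 i = 1) ∧ ∏ i ∈ Sk M p.1, p.2 i = signZ (b p.1)}

/-- `v` and `w` are joined by an edge of color `({l,k}, δ|_{S_l ∩ S_k})` in `G(M,b)`. -/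
def adjC {m n : ℕ} (M : Matrix (Fin m) (Fin n) (ZMod 2)) (b : Fin m → ZMod 2)
    (l k : Fin m) (δ : Fin n → ℤˣ) (v w : GVertex M b) : Prop :=
  ((v.1.1 = l ∧ w.1.1 = k) ∨ (v.1.1 = k ∧ w.1.1 = l)) ∧ v ≠ w ∧
    (Sk M l ∩ Sk M k).Nonempty ∧
    ∀ i ∈ Sk M l ∩ Sk M k, v.1.2 i * w.1.2 i = δ i

open Classical in
/-- The 0/1 adjacency matrix (with entries in `A`) of the color class
`({l,k}, δ|_{S_l ∩ S_k})` of the colored graph `G(M,b)`. -/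
noncomputable def adjMat (A : Type*) [Zero A] [One A] {m n : ℕ}
    (M : Matrix (Fin m) (Fin n) (ZMod 2)) (b : Fin m → ZMod 2)
    (l k : Fin m) (δ : Fin n → ℤˣ) (v w : GVertex M b) : A :=
  if adjC M b l k δ v w then 1 else 0

/-- `u` satisfies the `Qut(G(M,b))` relations: entries vanish between distinct
vertex colors, and `u` commutes with every edge-color adjacency matrix. -/
def QutRel (A : Type*) [Ring A] {m n : ℕ} (M : Matrix (Fin m) (Fin n) (ZMod 2))
    (b : Fin m → ZMod 2) (u : GVertex M b → GVertex M b → A) : Prop :=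
  (∀ v w : GVertex M b, v.1.1 ≠ w.1.1 → u v w = 0) ∧
  ∀ (l k : Fin m) (δ : Fin n → ℤˣ) (v w : GVertex M b),
    ∑ x, adjMat A M b l k δ v x * u x w = ∑ x, u v x * adjMat A M b l k δ x w

/-- `u` (rows indexed by `V(G(M,b))`, columns by `V(G(M,b'))`) satisfies the
isomorphism relations: entries vanish between distinct vertex colors and
`A_c u = u A'_c` for every edge color `c`. -/
def IsoRel (A : Type*) [Ring A] {m n : ℕ} (M : Matrix (Fin m) (Fin n) (ZMod 2))
    (b b' : Fin m → ZMod 2) (u : GVertex M b → GVertex M b' → A) : Prop :=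
  (∀ (v : GVertex M b) (w : GVertex M b'), v.1.1 ≠ w.1.1 → u v w = 0) ∧
  ∀ (l k : Fin m) (δ : Fin n → ℤˣ) (v : GVertex M b) (w : GVertex M b'),
    ∑ x, adjMat A M b l k δ v x * u x w = ∑ y, u v y * adjMat A M b' l k δ y w

/-- The element `y_i = ∑_{β ∈ ±1^{S_k}_{b'_k}} α_i β_i · u_{(k,α),(k,β)}`, computed
from the representative row vertex `v = (k, α)`. -/
def yRep {m n : ℕ} {M : Matrix (Fin m) (Fin n) (ZMod 2)} {b b' : Fin m → ZMod 2}
    {A : Type*} [Ring A] (u : GVertex M b → GVertex M b' → A)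
    (v : GVertex M b) (i : Fin n) : A :=
  ∑ w ∈ Finset.univ.filter (fun w : GVertex M b' => w.1.1 = v.1.1),
    ((v.1.2 i * w.1.2 i : ℤˣ) : ℤ) • u v w

section CStarProjections

open Complex NormedSpace

/-- In a C*-algebra a vanishing finite sum of elements `x* x` has only zero terms. -/
theorem eq_zero_of_sum_star_mul_self_eq_zero {ι B : Type*} [NonUnitalCStarAlgebra B]
    (s : Finset ι) (x : ι → B) (h : ∑ i ∈ s, star (x i) * x i = 0) {i : ι} (hi : i ∈ s) :
    x i = 0 := by
  let _ : PartialOrder B := CStarAlgebra.spectralOrder B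
  have _ : StarOrderedRing B := CStarAlgebra.spectralOrderedRing B
  rw [Finset.sum_eq_zero_iff_of_nonneg fun _ _ => star_mul_self_nonneg _] at h
  exact (CStarRing.star_mul_self_eq_zero_iff _).1 (h i hi)

/-- If a positive multiple of the identity plus a sum of commuting idempotents kills `x`,
then `x = 0`. -/
theorem eq_zero_of_nsmul_add_sum_idempotent_mul {ι R : Type*} [Ring R] [Module ℚ R]
    (q : ι → R) (hq : ∀ i, q i * q i = q i) (hc : ∀ i j, q i * q j = q j * q i)
    (s : Finset ι) (N : ℕ) (x : R) (h : (N + 1) • x + ∑ i ∈ s, q i * x = 0) : x = 0 := by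
  classical
  induction s using Finset.induction_on generalizing N x with
  | empty =>
    rw [Finset.sum_empty, add_zero, ← Nat.cast_smul_eq_nsmul ℚ] at h
    exact (smul_eq_zero.1 h).resolve_left (by positivity)
  | insert a s ha ih =>
    rw [Finset.sum_insert ha] at h
    have hax : q a * x = 0 := by
      refine ih (N + 1) _ ?_
      have h' := congrArg (q a * ·) h
      simp only [mul_add, mul_zero, mul_smul_comm, Finset.mul_sum, ← mul_assoc, hq] at h'
      simp only [← mul_assoc, hc _ a]
      rw [← h', succ_nsmul (q a * x) (N + 1)]
      abel
    rw [hax, zero_add] at h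
    exact ih N x h

theorem smul_eq_re_add_im_I {E : Type*} [AddCommGroup E] [Module ℂ E] (z : ℂ) (x : E) : z • x = z.re • x + z.im • ((I : ℂ) • x) := by
  conv_lhs => rw [← re_add_im z]
  rw [add_smul, mul_smul, Complex.coe_smul, Complex.coe_smul]

variable {A : Type*} [NormedRing A] [StarRing A] [NormedAlgebra ℂ A]

/-- The image under `star` of the imaginary unit. It is a central square root of `-1`; the
involution is conjugate-linear where it acts as `-I`, and linear where it acts as `I`. -/
noncomputable def starI (A : Type*) [NormedRing A] [StarRing A] [NormedAlgebra ℂ A] : A :=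
  star ((I : ℂ) • (1 : A))

theorem star_I_smul (x : A) : star ((I : ℂ) • x) = star x * starI A := by
  rw [starI, ← star_mul, smul_one_mul]

theorem starI_mul_comm (x : A) : starI A * x = x * starI A := by
  have h : star x * ((I : ℂ) • (1 : A)) = ((I : ℂ) • (1 : A)) * star x := by simp
  rw [starI]
  simpa only [star_mul, star_star] using congrArg star h

theorem star_starI : star (starI A) = (I : ℂ) • (1 : A) := by
  rw [starI, star_star]

theorem starI_mul_starI : starI A * starI A = -1 := by
  rw [starI, ← star_mul, smul_one_mul, smul_smul, I_mul_I]
  simp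

theorem star_real_smul [CStarRing A] (r : ℝ) (x : A) : star (r • x) = r • star x :=
  map_real_smul (starAddEquiv : A ≃+ A) continuous_star r x

/-- The ideal on which the involution is conjugate-linear. -/
noncomputable def conjLinearPart (A : Type*) [NormedRing A] [StarRing A] [NormedAlgebra ℂ A] :
    NonUnitalStarSubalgebra ℂ A where
  carrier := {x | starI A * x = -((I : ℂ) • x)}
  zero_mem' := by simp
  add_mem' {x y} hx hy := by
    simp only [Set.mem_ofPred_eq] at *
    rw [mul_add, hx, hy, smul_add, neg_add]
  mul_mem' {x y} hx hy := by
    simp only [Set.mem_ofPred_eq] at *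
    rw [← mul_assoc, hx, neg_mul, smul_mul_assoc]
  smul_mem' z x hx := by
    simp only [Set.mem_ofPred_eq] at *
    rw [mul_smul_comm, hx, smul_neg, smul_comm]
  star_mem' {x} hx := by
    simp only [Set.mem_ofPred_eq] at *
    have h := congrArg star hx
    rw [star_mul, star_starI, star_neg, star_I_smul, mul_smul_comm, mul_one] at h
    rw [starI_mul_comm, h, neg_neg]

theorem mem_conjLinearPart {x : A} :
    x ∈ conjLinearPart A ↔ starI A * x = -((I : ℂ) • x) := Iff.rfl

variable [CStarRing A]

theorem star_smul_of_mem_conjLinearPart {x : A} (hx : x ∈ conjLinearPart A) (z : ℂ) :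
    star (z • x) = star z • star x := by
  have h := mem_conjLinearPart.1 (star_mem hx)
  rw [smul_eq_re_add_im_I, smul_eq_re_add_im_I (star z), star_add, star_real_smul,
    star_real_smul, star_I_smul, ← starI_mul_comm, h]
  simp

noncomputable instance [CompleteSpace A] : NonUnitalCStarAlgebra (conjLinearPart A) where
  toCompleteSpace := by
    have h : IsClosed (conjLinearPart A : Set A) := isClosed_eq (by fun_prop) (by fun_prop)
    exact h.completeSpace_coe
  norm_mul_self_le x := (CStarRing.norm_star_mul_self (x := (x : A))).symm.le
  star_smul z x := Subtype.ext (star_smul_of_mem_conjLinearPart x.2 z)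

/-- Where the involution is linear, every skew-adjoint element vanishes. -/
theorem eq_zero_of_star_eq_neg_of_linear [CompleteSpace A] {k : A}
    (hk : starI A * k = (I : ℂ) • k) (hs : star k = -k) : k = 0 := by
  let _ : NormedAlgebra ℚ A := .restrictScalars ℚ ℂ A
  have hskew (z : ℂ) : z • k ∈ skewAdjoint A := by
    rw [skewAdjoint.mem_iff, smul_eq_re_add_im_I, star_add, star_real_smul, star_real_smul,
      star_I_smul, hs, ← starI_mul_comm, mul_neg, hk]
    simp [add_comm]
  have hf : Differentiable ℂ fun z : ℂ => exp (z • k) := by fun_prop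
  have hb : Bornology.IsBounded (Set.range fun z : ℂ => exp (z • k)) := by
    refine isBounded_iff_forall_norm_le.2 ⟨‖(1 : A)‖ + 1, ?_⟩
    rintro _ ⟨z, rfl⟩
    have hu := exp_mem_unitary_of_mem_skewAdjoint (hskew z)
    have hn := CStarRing.norm_star_mul_self (x := exp (z • k))
    rw [Unitary.star_mul_self_of_mem hu] at hn
    nlinarith [norm_nonneg (exp (z • k)), norm_nonneg (1 : A)]
  have hd : HasDerivAt (fun z : ℂ => exp (z • k)) k 0 := by
    simpa using hasDerivAt_exp_smul_const k (0 : ℂ)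
  have hconst : (fun z : ℂ => exp (z • k)) = fun _ => exp ((0 : ℂ) • k) :=
    funext fun z => hf.apply_eq_apply_of_bounded hb z 0
  rw [hconst] at hd
  exact hd.unique (hasDerivAt_const _ _)

/-- Self-adjoint projections summing to `1` are pairwise orthogonal. No compatibility of the
involution with complex scalars is assumed. -/
theorem mul_eq_zero_of_sum_projections_eq_one [CompleteSpace A] {ι : Type*} [Fintype ι]
    (p : ι → A) (hstar : ∀ i, star (p i) = p i) (hidem : ∀ i, p i * p i = p i)
    (hsum : ∑ i, p i = 1) {i j : ι} (hij : i ≠ j) : p i * p j = 0 := by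
  classical
  set d : A := (I : ℂ) • starI A with hd
  have hdc (x : A) : d * x = x * d := by
    rw [hd, smul_mul_assoc, starI_mul_comm, mul_smul_comm]
  have hdd : d * d = 1 := by
    rw [hd, smul_mul_smul_comm, I_mul_I, starI_mul_starI]; simp
  have hds : star d = d := by
    rw [hd, star_I_smul, star_starI, smul_one_mul]
  have hcd : starI A * d = -((I : ℂ) • 1) := by
    rw [hd, mul_smul_comm, starI_mul_starI, smul_neg]
  have hIc : starI A = -((I : ℂ) • d) := by
    rw [hd, smul_smul, I_mul_I]; simp
  have hi : i ∈ Finset.univ.erase j := by simpa using hij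
  have hf : (1 + d) * (p i * p j) = 0 := by
    have hmem (l : ι) : (1 + d) * (p l * p j) ∈ conjLinearPart A := by
      rw [mem_conjLinearPart, ← mul_assoc, mul_add, mul_one, hcd, hIc, ← smul_mul_assoc,
        ← neg_mul, smul_add, neg_add, add_comm]
    have := eq_zero_of_sum_star_mul_self_eq_zero (Finset.univ.erase j)
      (fun l => (⟨_, hmem l⟩ : conjLinearPart A)) ?_ hi
    · exact congrArg Subtype.val this
    · apply Subtype.ext
      have hterm (l : ι) : star ((1 + d) * (p l * p j)) * ((1 + d) * (p l * p j))
          = (1 + d) * (1 + d) * (p j * p l * p j) := by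
        have h1 : p j * p l * (1 + d) = (1 + d) * (p j * p l) := by
          rw [mul_add, add_mul, hdc]; simp
        rw [star_mul, star_mul, star_add, hds, star_one, hstar, hstar, mul_assoc (p j * p l),
          ← mul_assoc (1 + d), ← mul_assoc (p j * p l), ← mul_assoc (p j * p l), h1,
          mul_assoc (1 + d), h1]
        simp only [mul_assoc]
        rw [← mul_assoc (p l) (p l), hidem]
      have hsum' : ∑ l ∈ Finset.univ.erase j, p j * p l * p j = 0 := by
        have h := Finset.add_sum_erase Finset.univ (fun l => p j * p l * p j) (Finset.mem_univ j)
        simp only [← Finset.sum_mul, ← Finset.mul_sum] at h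
        rw [hsum, mul_one, hidem, hidem] at h
        rw [← Finset.sum_mul, ← Finset.mul_sum]
        exact add_eq_left.1 h
      have : ∑ l ∈ Finset.univ.erase j,
          star ((1 + d) * (p l * p j)) * ((1 + d) * (p l * p j)) = 0 := by
        simp only [hterm]
        rw [← Finset.mul_sum, hsum', mul_zero]
      simpa using this
  have hcomm (a b : ι) : (1 - d) * (p a * p b) = (1 - d) * (p b * p a) := by
    rw [← sub_eq_zero, ← mul_sub]
    apply eq_zero_of_star_eq_neg_of_linear
    · rw [← mul_assoc, mul_sub (starI A), mul_one, hcd, hIc, ← smul_mul_assoc, smul_sub]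
      congr 1
      abel
    · have h1 (x : A) : x * (1 - d) = (1 - d) * x := by
        rw [mul_sub, sub_mul, hdc]; simp
      rw [star_mul, star_sub, star_sub, star_mul, star_mul, hds, star_one, hstar, hstar, h1,
        ← mul_neg, neg_sub]
  have he : (1 - d) * (p i * p j) = 0 := by
    let _ : Module ℚ A := Module.compHom A (algebraMap ℚ ℂ)
    set e : A := (2⁻¹ : ℂ) • (1 - d) with he
    have hec (x : A) : x * e = e * x := by
      rw [he, mul_smul_comm, smul_mul_assoc, mul_sub, sub_mul, hdc]; simp
    have hee : e * e = e := by
      have h1 : (1 - d) * (1 - d) = (2 : ℂ) • (1 - d) := by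
        rw [mul_sub, sub_mul, sub_mul, hdd, two_smul]; simp only [one_mul, mul_one]; abel
      rw [he, smul_mul_smul_comm, h1, smul_smul]; norm_num
    have hep (a b : ι) : e * (p a * p b) = e * (p b * p a) := by
      rw [he, smul_mul_assoc, hcomm, smul_mul_assoc]
    have hmul (a b : ι) : e * p a * (e * p b) = e * (p a * p b) := by
      rw [mul_assoc, ← mul_assoc (p a), hec, mul_assoc e (p a), ← mul_assoc e e, hee]
    have hsum' : ∑ l ∈ Finset.univ.erase j, e * p l * (e * p j) = 0 := by
      have h := Finset.add_sum_erase Finset.univ (fun l => e * p l * (e * p j))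
        (Finset.mem_univ j)
      simp only [← Finset.sum_mul, ← Finset.mul_sum] at h
      rw [hsum, mul_one, hmul, hidem, ← mul_assoc e e, hee] at h
      rw [← Finset.sum_mul, ← Finset.mul_sum]
      exact add_eq_left.1 h
    have hzero : e * (p i * p j) = 0 := by
      refine eq_zero_of_nsmul_add_sum_idempotent_mul (fun l => e * p l)
        (fun l => by rw [hmul, hidem]) (fun a b => by rw [hmul, hmul, hep])
        ((Finset.univ.erase j).erase i) 0 _ ?_
      have h := congrArg (e * p i * ·) hsum'
      simp only [Finset.mul_sum, mul_zero] at h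
      rw [← Finset.add_sum_erase _ _ hi] at h
      rw [zero_add, one_smul, ← h, ← mul_assoc (e * p i), hmul i i, hidem, hmul]
      congr 1
      refine Finset.sum_congr rfl fun l _ => ?_
      rw [← hmul i j, ← mul_assoc, ← mul_assoc (e * p i), hmul l i, hmul i l, hep]
    have h2 : (1 - d) * (p i * p j) = (2 : ℂ) • (e * (p i * p j)) := by
      rw [he, smul_mul_assoc, smul_smul]; norm_num
    rw [h2, hzero, smul_zero]
  have h2 : (2 : ℂ) • (p i * p j) = 0 := by
    rw [two_smul]
    calc _ = (1 + d) * (p i * p j) + (1 - d) * (p i * p j) := by noncomm_ring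
      _ = 0 := by rw [hf, he, add_zero]
  exact (smul_eq_zero.1 h2).resolve_left two_ne_zero

end CStarProjections

section SolutionGroup

variable {m n : ℕ} {M : Matrix (Fin m) (Fin n) (ZMod 2)} {b b' : Fin m → ZMod 2}

theorem mem_Sk {k : Fin m} {i : Fin n} : i ∈ Sk M k ↔ M k i = 1 := by
  simp [Sk]

theorem signZ_mul_signZ (x y : ZMod 2) : signZ x * signZ y = if x = y then 1 else -1 := by
  revert x y
  decide

theorem units_mul_eq_mul_swap {x y z w : ℤˣ} (h : x * y = z * w) : x * z = y * w := by
  revert x y z w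
  decide

/-- A block with nonempty support carries a vertex of `G(M,b)`. -/
theorem exists_vertex_of_mem_Sk (b : Fin m → ZMod 2) {k : Fin m} {i : Fin n} (hi : i ∈ Sk M k) :
    ∃ v : GVertex M b, v.1.1 = k := by
  refine ⟨⟨(k, fun j => if j = i then signZ (b k) else 1), fun j hj => ?_, ?_⟩, rfl⟩
  · exact if_neg fun h : j = i => hj (h ▸ hi)
  · simp [Finset.prod_ite_eq', hi]

section Ring

variable {A : Type*} [Ring A] {u : GVertex M b → GVertex M b' → A}

theorem yRep_eq_sum (hcol : ∀ v w, v.1.1 ≠ w.1.1 → u v w = 0) (v : GVertex M b) (i : Fin n) :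
    yRep u v i = ∑ w, ((v.1.2 i * w.1.2 i : ℤˣ) : ℤ) • u v w := by
  refine Finset.sum_subset (Finset.filter_subset _ _) fun w _ hw => ?_
  rw [hcol v w fun h => hw (by simp [h]), smul_zero]

/-- Integer combinations of orthogonal projections multiply coefficientwise. -/
theorem sum_smul_mul_sum_smul_of_orthogonal {ι : Type*} [Fintype ι] {p : ι → A}
    (hidem : ∀ i, p i * p i = p i) (horth : ∀ i j, i ≠ j → p i * p j = 0) (c d : ι → ℤ) :
    (∑ i, c i • p i) * ∑ i, d i • p i = ∑ i, (c i * d i) • p i := by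
  rw [Finset.sum_mul]
  refine Finset.sum_congr rfl fun i _ => ?_
  rw [Finset.mul_sum, Finset.sum_eq_single i]
  · rw [smul_mul_smul_comm, hidem]
  · intro j _ hj
    rw [smul_mul_smul_comm, horth i j hj.symm, smul_zero]
  · simp

/-- Products of entries vanish when the two row vertices and the two column vertices compare
differently at a common index. -/
theorem mul_eq_zero_of_isoRel (hidem : ∀ v w, u v w * u v w = u v w)
    (hrow : ∀ v w w', w ≠ w' → u v w * u v w' = 0)
    (hcolumn : ∀ w v v', v ≠ v' → u v w * u v' w = 0)
    (hiso : IsoRel A M b b' u) (v v' : GVertex M b) (w w' : GVertex M b') {i : Fin n}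
    (hv : M v.1.1 i = 1) (hv' : M v'.1.1 i = 1)
    (h : v.1.2 i * v'.1.2 i ≠ w.1.2 i * w'.1.2 i) : u v w * u v' w' = 0 := by
  by_cases hvv : v = v'
  · subst hvv
    refine hrow v w w' fun hww => h ?_
    rw [hww, Int.units_mul_self, Int.units_mul_self]
  have hi : i ∈ Sk M v.1.1 ∩ Sk M v'.1.1 := by simp [mem_Sk, hv, hv']
  have key := congrArg (fun x => u v w * x * u v' w')
    (hiso.2 v.1.1 v'.1.1 (fun j => v.1.2 j * v'.1.2 j) v w')
  have hadj : adjC M b v.1.1 v'.1.1 (fun j => v.1.2 j * v'.1.2 j) v v' :=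
    ⟨Or.inl ⟨rfl, rfl⟩, hvv, ⟨i, hi⟩, fun _ _ => rfl⟩
  have hnadj : ¬ adjC M b' v.1.1 v'.1.1 (fun j => v.1.2 j * v'.1.2 j) w w' :=
    fun hw => h (hw.2.2.2 i hi).symm
  rw [Finset.mul_sum, Finset.sum_mul, Finset.sum_eq_single v', Finset.mul_sum,
    Finset.sum_eq_single w] at key
  · simpa [adjMat, hadj, hnadj, mul_assoc, hidem] using key
  · intro y _ hy
    rw [← mul_assoc, hrow v w y hy.symm, zero_mul]
  · simp
  · intro x _ hx
    rw [mul_assoc, mul_assoc, hcolumn w' x v' hx, mul_zero, mul_zero]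
  · simp

theorem yRep_eq_yRep (hidem : ∀ v w, u v w * u v w = u v w)
    (hrow : ∀ v w w', w ≠ w' → u v w * u v w' = 0)
    (hcolumn : ∀ w v v', v ≠ v' → u v w * u v' w = 0)
    (hsum : ∀ v, ∑ w, u v w = 1) (hiso : IsoRel A M b b' u) (i : Fin n) (v v' : GVertex M b)
    (hv : M v.1.1 i = 1) (hv' : M v'.1.1 i = 1) : yRep u v i = yRep u v' i := by
  rw [yRep_eq_sum hiso.1, yRep_eq_sum hiso.1]
  calc _ = ∑ w, ∑ w', ((v.1.2 i * w.1.2 i : ℤˣ) : ℤ) • (u v w * u v' w') := by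
        simp only [← Finset.smul_sum, ← Finset.mul_sum, hsum, mul_one]
    _ = ∑ w, ∑ w', ((v'.1.2 i * w'.1.2 i : ℤˣ) : ℤ) • (u v w * u v' w') := by
        refine Finset.sum_congr rfl fun w _ => Finset.sum_congr rfl fun w' _ => ?_
        by_cases h : v.1.2 i * v'.1.2 i = w.1.2 i * w'.1.2 i
        · rw [units_mul_eq_mul_swap h]
        · rw [mul_eq_zero_of_isoRel hidem hrow hcolumn hiso v v' w w' hv hv' h, smul_zero,
            smul_zero]
    _ = _ := by
        rw [Finset.sum_comm]
        simp only [← Finset.smul_sum, ← Finset.sum_mul, hsum, one_mul]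

theorem prod_map_yRep (hidem : ∀ v w, u v w * u v w = u v w)
    (hrow : ∀ v w w', w ≠ w' → u v w * u v w' = 0) (hsum : ∀ v, ∑ w, u v w = 1)
    (hcol : ∀ v w, v.1.1 ≠ w.1.1 → u v w = 0) (v : GVertex M b) (l : List (Fin n)) :
    (l.map fun i => yRep u v i).prod
      = ∑ w, (((l.map fun i => v.1.2 i * w.1.2 i).prod : ℤˣ) : ℤ) • u v w := by
  induction l with
  | nil => simp [hsum]
  | cons i l ih =>
    rw [List.map_cons, List.prod_cons, ih, yRep_eq_sum hcol,
      sum_smul_mul_sum_smul_of_orthogonal (hidem v) (hrow v)]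
    simp

theorem prod_sort_Sk_map_yRep (hidem : ∀ v w, u v w * u v w = u v w)
    (hrow : ∀ v w w', w ≠ w' → u v w * u v w' = 0) (hsum : ∀ v, ∑ w, u v w = 1)
    (hcol : ∀ v w, v.1.1 ≠ w.1.1 → u v w = 0) (v : GVertex M b) :
    (((Sk M v.1.1).sort (· ≤ ·)).map (fun i => yRep u v i)).prod
      = if b v.1.1 = b' v.1.1 then 1 else -1 := by
  rw [prod_map_yRep hidem hrow hsum hcol]
  calc _ = ∑ w, ((if b v.1.1 = b' v.1.1 then 1 else -1 : ℤˣ) : ℤ) • u v w := by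
        refine Finset.sum_congr rfl fun w _ => ?_
        by_cases hw : v.1.1 = w.1.1
        · congr 2
          rw [← List.prod_toFinset _ (Finset.sort_nodup _ _), Finset.sort_toFinset,
            Finset.prod_mul_distrib, v.2.2, hw, w.2.2, signZ_mul_signZ]
        · rw [hcol v w hw, smul_zero, smul_zero]
    _ = _ := by
        rw [← Finset.smul_sum, hsum]
        split_ifs <;> simp

end Ring

end SolutionGroup

/-- For a magic unitary `u` satisfying the isomorphism relations between `G(M,b)` and
`G(M,b')`, the element `y_i` is independent of the choice of block `k` with `i ∈ S_k`
and of the representative `α ∈ ±1^{S_k}_{b_k}`; each `y_i` is a self-adjoint involution;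
`y_i` and `y_j` commute whenever `i,j ∈ S_k` for some `k`; and
`∏_{i ∈ S_k} y_i = (-1)^{b_k + b'_k}` (product in increasing order of indices). -/
theorem yIsoSolutionGroupRelations {m n : ℕ} (M : Matrix (Fin m) (Fin n) (ZMod 2))
    (b b' : Fin m → ZMod 2)
    {A : Type*} [NormedRing A] [StarRing A] [CStarRing A] [NormedAlgebra ℂ A]
    [CompleteSpace A]
    (u : GVertex M b → GVertex M b' → A)
    (hmu : IsMagicUnitary u) (hiso : IsoRel A M b b' u) :
    (∀ (i : Fin n) (v v' : GVertex M b), M v.1.1 i = 1 → M v'.1.1 i = 1 →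
      yRep u v i = yRep u v' i) ∧
    (∀ (i : Fin n) (v : GVertex M b), M v.1.1 i = 1 →
      star (yRep u v i) = yRep u v i ∧ yRep u v i * yRep u v i = 1) ∧
    (∀ (k : Fin m) (i j : Fin n), i ∈ Sk M k → j ∈ Sk M k →
      ∀ v w : GVertex M b, M v.1.1 i = 1 → M w.1.1 j = 1 →
        yRep u v i * yRep u w j = yRep u w j * yRep u v i) ∧
    (∀ (k : Fin m) (v : GVertex M b), v.1.1 = k →
      (((Sk M k).sort (· ≤ ·)).map (fun i => yRep u v i)).prod
        = if b k = b' k then 1 else -1) := by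
  obtain ⟨hstar, hidem, hsum, hsum'⟩ := hmu
  have hrow : ∀ v w w', w ≠ w' → u v w * u v w' = 0 := fun v _ _ h =>
    mul_eq_zero_of_sum_projections_eq_one (u v) (hstar v) (hidem v) (hsum v) h
  have hcolumn : ∀ w v v', v ≠ v' → u v w * u v' w = 0 := fun w _ _ h =>
    mul_eq_zero_of_sum_projections_eq_one (fun v => u v w) (fun v => hstar v w)
      (fun v => hidem v w) (hsum' w) h
  have hindep := yRep_eq_yRep hidem hrow hcolumn hsum hiso
  refine ⟨hindep, fun i v _ => ⟨?_, ?_⟩, fun k i j hi hj v w hv hw => ?_, ?_⟩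
  · simp only [yRep, star_sum, star_zsmul, hstar]
  · rw [yRep_eq_sum hiso.1, sum_smul_mul_sum_smul_of_orthogonal (hidem v) (hrow v)]
    simp only [← Units.val_mul, Int.units_mul_self, Units.val_one, one_smul, hsum]
  · obtain ⟨x, rfl⟩ := exists_vertex_of_mem_Sk b hi
    rw [hindep i v x hv (mem_Sk.1 hi), hindep j w x hw (mem_Sk.1 hj), yRep_eq_sum hiso.1,
      yRep_eq_sum hiso.1, sum_smul_mul_sum_smul_of_orthogonal (hidem x) (hrow x),
      sum_smul_mul_sum_smul_of_orthogonal (hidem x) (hrow x)]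
    simp only [mul_comm]
  · rintro _ v rfl
    exact prod_sort_Sk_map_yRep hidem hrow hsum hiso.1 v
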